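/- arXiv:2304.13432 — 2 statements merged into one kernel-verified Lean document; each statement's English description precedes it below -/
import Mathlib

section
/- Let π be a nonlinear permutation of F_2^m (some second-order derivative of π is not identically zero) and define f : F_2^m × F_2^m → F_2 by f(x,y) = x·π(y). Then F_2^m × {0} is the unique m-dimensional M-subspace of f if and only if for every subspace S of F_2^m with dim S ≥ 1 such that D_a D_b π is identically zero for all a, b ∈ S, setting k = m − dim S, there do not exist linearly independent vectors u_1, …, u_k ∈ F_2^m with u_i · D_a π(y) = 0 for all a ∈ S, all y ∈ F_2^m and all i = 1, …, k. Moreover, when F_2^m × {0} is the unique m-dimensional M-subspace of f, every such subspace S with dim S ≥ 1 necessarily satisfies dim S ≤ m−2 (i.e., 2 ≤ k ≤ m−1). -/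
open scoped BigOperators

/-- The vector space `F_2^n`. -/
abbrev BV (n : ℕ) := Fin n → ZMod 2

/-- Dot product on `F_2^n`. -/
def dotp {n : ℕ} (x y : BV n) : ZMod 2 := ∑ i, x i * y i

/-- `W` is an M-subspace of `f` : all second-order derivatives of `f` in directions
from `W` vanish identically. -/
def IsMSub {M : Type} [AddCommGroup M] [Module (ZMod 2) M] (f : M → ZMod 2)
    (W : Submodule (ZMod 2) M) : Prop :=
  ∀ a ∈ W, ∀ b ∈ W, ∀ x, f x + f (x + a) + f (x + b) + f (x + a + b) = 0


theorem dotp_eq_dotProduct {n : ℕ} (x y : BV n) : dotp x y = x ⬝ᵥ y := rfl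

theorem dotp_add_right {n : ℕ} (x y z : BV n) : dotp x (y + z) = dotp x y + dotp x z :=
  dotProduct_add x y z

theorem dotp_add_left {n : ℕ} (x y z : BV n) : dotp (x + y) z = dotp x z + dotp y z :=
  add_dotProduct x y z

theorem BV.add_self {n : ℕ} (x : BV n) : x + x = 0 := ZModModule.add_self x

theorem finrank_submodule_prod {K M N : Type*} [DivisionRing K] [AddCommGroup M] [Module K M]
    [AddCommGroup N] [Module K N] [FiniteDimensional K M] [FiniteDimensional K N]
    (p : Submodule K M) (q : Submodule K N) :
    Module.finrank K (p.prod q) = Module.finrank K p + Module.finrank K q := by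
  let e : (p.prod q) ≃ₗ[K] p × q :=
    { toFun := fun x => (⟨x.1.1, x.2.1⟩, ⟨x.1.2, x.2.2⟩)
      invFun := fun x => ⟨(x.1, x.2), x.1.2, x.2.2⟩
      map_add' := fun _ _ => rfl
      map_smul' := fun _ _ => rfl }
  rw [e.finrank_eq, Module.finrank_prod]

/-- `π` has vanishing second-order derivatives in directions from `S`. -/
def VanishingSecondDeriv {m : ℕ} (π : BV m → BV m) (S : Submodule (ZMod 2) (BV m)) : Prop :=
  ∀ a ∈ S, ∀ b ∈ S, ∀ x, π x + π (x + a) + π (x + b) + π (x + a + b) = 0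

/-- There are `m - dim S` linearly independent vectors orthogonal to all first-order derivatives
of `π` in directions from `S`. -/
def HasOrthogonalFamily {m : ℕ} (π : BV m → BV m) (S : Submodule (ZMod 2) (BV m)) : Prop :=
  ∃ u : Fin (m - Module.finrank (ZMod 2) ↥S) → BV m,
    LinearIndependent (ZMod 2) u ∧ ∀ i, ∀ a ∈ S, ∀ y, dotp (u i) (π (y + a) + π y) = 0

theorem secondDeriv_eq {m : ℕ} (π : BV m → BV m) {f : BV m × BV m → ZMod 2}
    (hf : ∀ x y, f (x, y) = dotp x (π y)) (a b p : BV m × BV m) :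
    f p + f (p + a) + f (p + b) + f (p + a + b) =
      dotp p.1 (π p.2 + π (p.2 + a.2) + π (p.2 + b.2) + π (p.2 + a.2 + b.2)) +
      dotp a.1 (π (p.2 + a.2 + b.2) + π (p.2 + a.2)) +
      dotp b.1 (π (p.2 + a.2 + b.2) + π (p.2 + b.2)) := by
  obtain ⟨a₁, a₂⟩ := a
  obtain ⟨b₁, b₂⟩ := b
  obtain ⟨x, y⟩ := p
  simp only [Prod.mk_add_mk, hf, dotp_add_left, dotp_add_right]
  ring

theorem isMSub_prod {m : ℕ} {π : BV m → BV m} {f : BV m × BV m → ZMod 2}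
    (hf : ∀ x y, f (x, y) = dotp x (π y)) {V S : Submodule (ZMod 2) (BV m)}
    (hS : VanishingSecondDeriv π S)
    (hV : ∀ v ∈ V, ∀ a ∈ S, ∀ y, dotp v (π (y + a) + π y) = 0) : IsMSub f (V.prod S) := by
  intro a ha b hb p
  have h := hV b.1 hb.1 a.2 ha.2 (p.2 + b.2)
  rw [add_right_comm] at h
  rw [secondDeriv_eq π hf, hS a.2 ha.2 b.2 hb.2, hV a.1 ha.1 b.2 hb.2, h]
  simp [dotp]

theorem IsMSub.vanishingSecondDeriv {m : ℕ} {π : BV m → BV m} {f : BV m × BV m → ZMod 2}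
    (hf : ∀ x y, f (x, y) = dotp x (π y)) {W : Submodule (ZMod 2) (BV m × BV m)}
    (hW : IsMSub f W) : VanishingSecondDeriv π (W.map (LinearMap.snd (ZMod 2) _ _)) := by
  rintro _ ⟨a, ha, rfl⟩ _ ⟨b, hb, rfl⟩ y
  refine dotProduct_eq_zero _ fun x => ?_
  have h₁ := hW a ha b hb (x, y)
  have h₀ := hW a ha b hb (0, y)
  rw [secondDeriv_eq π hf] at h₁ h₀
  have h := congrArg₂ (· - ·) h₁ h₀
  rw [dotProduct_comm]
  simpa [dotp_eq_dotProduct] using h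

theorem IsMSub.dotp_eq_zero {m : ℕ} {π : BV m → BV m} {f : BV m × BV m → ZMod 2}
    (hf : ∀ x y, f (x, y) = dotp x (π y)) {W : Submodule (ZMod 2) (BV m × BV m)}
    (hW : IsMSub f W) {v : BV m} (hv : (v, 0) ∈ W) {b : BV m × BV m} (hb : b ∈ W) (y : BV m) :
    dotp v (π (y + b.2) + π y) = 0 := by
  have h := hW (v, 0) hv b hb (0, y)
  rw [secondDeriv_eq π hf] at h
  simpa [dotp_eq_dotProduct, BV.add_self] using h

theorem eq_top_prod_bot_of_map_snd_eq_bot {m : ℕ} {W : Submodule (ZMod 2) (BV m × BV m)}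
    (hd : Module.finrank (ZMod 2) W = m) (h : W.map (LinearMap.snd (ZMod 2) _ _) = ⊥) :
    W = (⊤ : Submodule (ZMod 2) (BV m)).prod ⊥ := by
  refine Submodule.eq_of_le_of_finrank_eq (fun p hp => ⟨trivial, ?_⟩) ?_
  · exact h ▸ Submodule.mem_map_of_mem hp
  · rw [hd, finrank_submodule_prod, finrank_top, finrank_bot, Module.finrank_fin_fun, add_zero]

theorem IsMSub.hasOrthogonalFamily {m : ℕ} {π : BV m → BV m} {f : BV m × BV m → ZMod 2}
    (hf : ∀ x y, f (x, y) = dotp x (π y)) {W : Submodule (ZMod 2) (BV m × BV m)}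
    (hd : Module.finrank (ZMod 2) W = m) (hW : IsMSub f W) :
    HasOrthogonalFamily π (W.map (LinearMap.snd (ZMod 2) _ _)) := by
  have hrk := ((LinearMap.snd (ZMod 2) (BV m) (BV m)).domRestrict W).finrank_range_add_finrank_ker
  rw [LinearMap.range_domRestrict, hd] at hrk
  set K := LinearMap.ker ((LinearMap.snd (ZMod 2) (BV m) (BV m)).domRestrict W)
  let B := Module.finBasisOfFinrankEq (ZMod 2) K (Nat.eq_sub_of_add_eq' hrk)
  have hK (k : K) : (k : BV m × BV m).2 = 0 := k.2
  let g : K →ₗ[ZMod 2] BV m := LinearMap.fst (ZMod 2) _ _ ∘ₗ W.subtype ∘ₗ K.subtype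
  have hg : Function.Injective g := fun k l hkl =>
    Subtype.ext (Subtype.ext (Prod.ext hkl ((hK k).trans (hK l).symm)))
  refine ⟨g ∘ B, B.linearIndependent.map' g (LinearMap.ker_eq_bot.2 hg), ?_⟩
  rintro i _ ⟨b, hb, rfl⟩ y
  refine hW.dotp_eq_zero hf ?_ hb y
  have : ((g ∘ B) i, (0 : BV m)) = (B i : BV m × BV m) := Prod.ext rfl (hK _).symm
  rw [this]
  exact (B i : W).2

theorem HasOrthogonalFamily.exists_isMSub {m : ℕ} {π : BV m → BV m} {f : BV m × BV m → ZMod 2}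
    (hf : ∀ x y, f (x, y) = dotp x (π y)) {S : Submodule (ZMod 2) (BV m)}
    (hS : VanishingSecondDeriv π S) (h : HasOrthogonalFamily π S) :
    ∃ V : Submodule (ZMod 2) (BV m),
      Module.finrank (ZMod 2) (V.prod S) = m ∧ IsMSub f (V.prod S) := by
  obtain ⟨u, hu, horth⟩ := h
  refine ⟨Submodule.span (ZMod 2) (Set.range u), ?_, isMSub_prod hf hS fun v hv a ha y => ?_⟩
  · have hle := S.finrank_le
    rw [Module.finrank_fin_fun] at hle
    rw [finrank_submodule_prod, finrank_span_eq_card hu,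
      Fintype.card_fin, Nat.sub_add_cancel hle]
  · induction hv using Submodule.span_induction with
    | mem v hv =>
      obtain ⟨i, rfl⟩ := hv
      exact horth i a ha y
    | zero => simp [dotp]
    | add v w _ _ hv hw => rw [dotp_add_left, hv, hw, add_zero]
    | smul c v _ hv => rw [dotp_eq_dotProduct, smul_dotProduct, ← dotp_eq_dotProduct, hv, smul_zero]

theorem exists_dotp_eq {m : ℕ} (φ : BV m →ₗ[ZMod 2] ZMod 2) : ∃ u, ∀ x, φ x = dotp u x := by
  refine ⟨(dotProductEquiv (ZMod 2) (Fin m)).symm φ, fun x => ?_⟩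
  exact (DFunLike.congr_fun ((dotProductEquiv (ZMod 2) (Fin m)).apply_symm_apply φ) x).symm

/-- If the second-order derivatives of an injective `π` vanish along a hyperplane `S`, then some
nonzero vector is orthogonal to all first-order derivatives of `π` along `S`. -/
theorem VanishingSecondDeriv.exists_orthogonal {m : ℕ} {π : BV m → BV m}
    (hπ : Function.Injective π) {S : Submodule (ZMod 2) (BV m)}
    (hS : VanishingSecondDeriv π S) (hd : Module.finrank (ZMod 2) S + 1 = m) :
    ∃ u : BV m, u ≠ 0 ∧ ∀ a ∈ S, ∀ y, dotp u (π (y + a) + π y) = 0 := by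
  let L : S →+ BV m := AddMonoidHom.mk' (fun a => π a + π 0) fun a b => by
    have h := hS a a.2 b b.2 0
    simp only [zero_add] at h
    have key : ∀ p q r s : ZMod 2, p + q + r + s = 0 → s + p = q + p + (r + p) := by decide
    exact funext fun i => key _ _ _ _ (congrFun h i)
  let L' : S →ₗ[ZMod 2] BV m := L.toZModLinearMap 2
  have hL (a : S) : L' a = π a + π 0 := rfl
  have hL'inj : Function.Injective L' := fun a b hab =>
    Subtype.ext (hπ (add_right_cancel hab))
  have hrange : Module.finrank (ZMod 2) (LinearMap.range L') + 1 = m := by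
    rw [LinearMap.finrank_range_of_inj hL'inj, hd]
  have hlt : LinearMap.range L' < ⊤ := Submodule.lt_top_of_finrank_lt_finrank (by
    rw [Module.finrank_fin_fun]; omega)
  obtain ⟨φ, hφ, hle⟩ := Submodule.exists_le_ker_of_lt_top _ hlt
  have hker : LinearMap.range L' = LinearMap.ker φ := by
    refine Submodule.eq_of_le_of_finrank_eq hle ?_
    have := Module.Dual.finrank_ker_add_one_of_ne_zero hφ
    rw [Module.finrank_fin_fun] at this
    omega
  have hmem (y : BV m) : φ (π y + π 0) = 0 ↔ y ∈ S := by
    rw [← LinearMap.mem_ker, ← hker]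
    constructor
    · rintro ⟨a, ha⟩
      exact hπ (add_right_cancel ha) ▸ a.2
    · exact fun hy => ⟨⟨y, hy⟩, rfl⟩
  obtain ⟨u, hu⟩ := exists_dotp_eq φ
  refine ⟨u, ?_, fun a ha y => ?_⟩
  · rintro rfl
    exact hφ (LinearMap.ext fun x => by simp [hu, dotp])
  · have hiff : φ (π (y + a) + π 0) = 0 ↔ φ (π y + π 0) = 0 := by
      rw [hmem, hmem, S.add_mem_iff_left ha]
    have key : ∀ p q r : ZMod 2, (p + r = 0 ↔ q + r = 0) → p + q = 0 := by decide
    rw [← hu, map_add]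
    rw [map_add, map_add] at hiff
    exact key _ _ _ hiff

theorem VanishingSecondDeriv.hasOrthogonalFamily {m : ℕ} {π : BV m → BV m}
    (hπ : Function.Injective π) {S : Submodule (ZMod 2) (BV m)}
    (hS : VanishingSecondDeriv π S) (hd : m ≤ Module.finrank (ZMod 2) S + 1) :
    HasOrthogonalFamily π S := by
  unfold HasOrthogonalFamily
  rcases hd.lt_or_eq with hlt | heq
  · have h : m - Module.finrank (ZMod 2) S = 0 := by omega
    rw [h]
    exact ⟨Fin.elim0, linearIndependent_empty_type, fun i => i.elim0⟩
  · have h : m - Module.finrank (ZMod 2) S = 1 := by omega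
    obtain ⟨u, hu, horth⟩ := hS.exists_orthogonal hπ heq.symm
    rw [h]
    exact ⟨fun _ => u, linearIndependent_unique_iff.2 hu, fun _ => horth⟩

theorem stmt6 {m : ℕ} (π : BV m → BV m) (hπ : Function.Bijective π)
    (hnl : ∃ a b : BV m, ¬ ∀ x, π x + π (x + a) + π (x + b) + π (x + a + b) = 0)
    (f : BV m × BV m → ZMod 2) (hf : ∀ x y, f (x, y) = dotp x (π y))
    (U : Submodule (ZMod 2) (BV m × BV m))
    (hU : U = (⊤ : Submodule (ZMod 2) (BV m)).prod (⊥ : Submodule (ZMod 2) (BV m))) :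
    ((IsMSub f U ∧ ∀ W : Submodule (ZMod 2) (BV m × BV m),
        Module.finrank (ZMod 2) ↥W = m → IsMSub f W → W = U) ↔
      (∀ S : Submodule (ZMod 2) (BV m), 1 ≤ Module.finrank (ZMod 2) ↥S →
        (∀ a ∈ S, ∀ b ∈ S, ∀ x, π x + π (x + a) + π (x + b) + π (x + a + b) = 0) →
        ¬ ∃ u : Fin (m - Module.finrank (ZMod 2) ↥S) → BV m,
          LinearIndependent (ZMod 2) u ∧
            ∀ i, ∀ a ∈ S, ∀ y, dotp (u i) (π (y + a) + π y) = 0)) ∧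
    ((IsMSub f U ∧ ∀ W : Submodule (ZMod 2) (BV m × BV m),
        Module.finrank (ZMod 2) ↥W = m → IsMSub f W → W = U) →
      ∀ S : Submodule (ZMod 2) (BV m), 1 ≤ Module.finrank (ZMod 2) ↥S →
        (∀ a ∈ S, ∀ b ∈ S, ∀ x, π x + π (x + a) + π (x + b) + π (x + a + b) = 0) →
        Module.finrank (ZMod 2) ↥S ≤ m - 2) := by
  subst hU
  have not_family (huniq : ∀ W : Submodule (ZMod 2) (BV m × BV m),
      Module.finrank (ZMod 2) ↥W = m → IsMSub f W → W = (⊤ : Submodule _ (BV m)).prod ⊥)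
      (S : Submodule (ZMod 2) (BV m)) (h1 : 1 ≤ Module.finrank (ZMod 2) S)
      (hS : VanishingSecondDeriv π S) : ¬ HasOrthogonalFamily π S := by
    intro h
    obtain ⟨V, hd, hV⟩ := h.exists_isMSub hf hS
    have hbot : S = ⊥ := by
      rw [eq_bot_iff]
      intro s hs
      have : ((0 : BV m), s) ∈ V.prod S := ⟨V.zero_mem, hs⟩
      rw [huniq _ hd hV] at this
      exact this.2
    rw [hbot, finrank_bot] at h1
    omega
  refine ⟨⟨fun h => not_family h.2, fun h => ⟨?_, fun W hd hW => ?_⟩⟩, fun h S h1 hS => ?_⟩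
  · refine isMSub_prod hf ?_ ?_
    · rintro a ha b hb x
      obtain rfl := (Submodule.mem_bot _).1 ha
      obtain rfl := (Submodule.mem_bot _).1 hb
      simp [BV.add_self]
    · rintro v - a ha y
      obtain rfl := (Submodule.mem_bot _).1 ha
      rw [add_zero, BV.add_self]
      exact dotProduct_zero v
  · refine eq_top_prod_bot_of_map_snd_eq_bot hd ?_
    by_contra hne
    exact h _ (Submodule.one_le_finrank_iff.2 hne) (hW.vanishingSecondDeriv hf)
      (hW.hasOrthogonalFamily hf hd)
  · by_contra hlt
    exact not_family h.2 S h1 hS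
      (VanishingSecondDeriv.hasOrthogonalFamily hπ.injective hS (by omega))
end

section
/- Let n = 2m, let f1 = f2 be a bent function in n variables that admits an m-dimensional M-subspace (i.e., f1 belongs to MM^#), and let f3 be a bent function in n variables all of whose M-subspaces have dimension at most m−2 (in particular f3 does not admit an M-subspace of dimension larger than m−2). Set f4 = 1 + f3. Then f = f1||f2||f3||f4 is a bent function in n+2 variables that has no (m+1)-dimensional M-subspace; i.e., f is bent and outside the completed Maiorana–McFarland class MM^#. -/
open scoped BigOperators

/-- The bent 4-concatenation `f = f1 || f2 || f3 || f4`: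
`f (x, y1, y2) = f1 x + y1 (f1 x + f3 x) + y2 (f1 x + f2 x)
  + y1 y2 (f1 x + f2 x + f3 x + f4 x)`. -/
def concat {X : Type} (f1 f2 f3 f4 : X → ZMod 2) :
    X × (ZMod 2 × ZMod 2) → ZMod 2 :=
  fun p =>
    f1 p.1 + p.2.1 * (f1 p.1 + f3 p.1) + p.2.2 * (f1 p.1 + f2 p.1)
      + p.2.1 * p.2.2 * (f1 p.1 + f2 p.1 + f3 p.1 + f4 p.1)

/-- Walsh–Hadamard transform of `f : F_2^n → F_2` at `a`. -/
def walsh {n : ℕ} (f : BV n → ZMod 2) (a : BV n) : ℤ :=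
  ∑ x : BV n, (-1 : ℤ) ^ (f x + dotp a x).val

/-- Walsh–Hadamard transform of a function on `F_2^n × F_2 × F_2` at `a`. -/
def walshC {n : ℕ} (f : BV n × (ZMod 2 × ZMod 2) → ZMod 2)
    (a : BV n × (ZMod 2 × ZMod 2)) : ℤ :=
  ∑ p : BV n × (ZMod 2 × ZMod 2),
    (-1 : ℤ) ^ (f p + dotp a.1 p.1 + a.2.1 * p.2.1 + a.2.2 * p.2.2).val

theorem isMSub_span_singleton {M : Type} [AddCommGroup M] [Module (ZMod 2) M]
    (f : M → ZMod 2) (v : M) : IsMSub f (Submodule.span (ZMod 2) {v}) := by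
  have hself (c : ZMod 2) : c + c = 0 := CharTwo.add_self_eq_zero c
  have hv : v + v = 0 := by
    rw [← one_smul (ZMod 2) v, ← add_smul, hself, zero_smul]
  intro a ha b hb x
  obtain ⟨c, rfl⟩ := Submodule.mem_span_singleton.1 ha
  obtain ⟨d, rfl⟩ := Submodule.mem_span_singleton.1 hb
  have hcases : ∀ c : ZMod 2, c = 0 ∨ c = 1 := by decide
  rcases hcases c with rfl | rfl <;> rcases hcases d with rfl | rfl <;>
    simp only [zero_smul, one_smul, add_zero, add_assoc, hv] <;> grind

theorem IsMSub.comap_inl_concat {M : Type} [AddCommGroup M] [Module (ZMod 2) M]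
    {f1 f2 f3 f4 : M → ZMod 2} {W : Submodule (ZMod 2) (M × (ZMod 2 × ZMod 2))}
    (hW : IsMSub (concat f1 f2 f3 f4) W) :
    IsMSub f3 (W.comap (LinearMap.inl (ZMod 2) M (ZMod 2 × ZMod 2))) := by
  intro a ha b hb x
  have h := hW _ ha _ hb (x, (1, 0))
  simp only [concat, LinearMap.inl_apply, Prod.mk_add_mk, add_zero] at h
  grind

theorem Submodule.finrank_le_finrank_comap_inl_add {K M N : Type*} [Field K]
    [AddCommGroup M] [Module K M] [FiniteDimensional K M]
    [AddCommGroup N] [Module K N] [FiniteDimensional K N] (W : Submodule K (M × N)) :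
    Module.finrank K W ≤ Module.finrank K (W.comap (LinearMap.inl K M N))
      + Module.finrank K N := by
  have hinj : Function.Injective (LinearMap.inl K M N) := LinearMap.inl_injective
  have hsup := Submodule.finrank_sup_add_finrank_inf_eq W (LinearMap.range (LinearMap.inl K M N))
  have htop := Submodule.finrank_le (W ⊔ LinearMap.range (LinearMap.inl K M N))
  rw [LinearMap.finrank_range_of_inj hinj] at hsup
  rw [Module.finrank_prod] at htop
  rw [(Submodule.equivMapOfInjective _ hinj _).finrank_eq, Submodule.map_comap_eq, inf_comm]
  omega

theorem neg_one_pow_val_add (c d : ZMod 2) :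
    (-1 : ℤ) ^ (c + d).val = (-1) ^ c.val * (-1) ^ d.val := by
  revert c d; decide

theorem walshC_eq {n : ℕ} (f : BV n × (ZMod 2 × ZMod 2) → ZMod 2) (a : BV n) (b c : ZMod 2) :
    walshC f (a, (b, c)) =
      walsh (fun x => f (x, (0, 0))) a
        + (-1) ^ c.val * walsh (fun x => f (x, (0, 1))) a
        + (-1) ^ b.val * (walsh (fun x => f (x, (1, 0))) a
        + (-1) ^ c.val * walsh (fun x => f (x, (1, 1))) a) := by
  have huniv (g : ZMod 2 → ℤ) : ∑ y, g y = g 0 + g 1 := Fin.sum_univ_two g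
  simp only [walshC, walsh, Fintype.sum_prod_type, huniv, Finset.mul_sum, ← Finset.sum_add_distrib]
  refine Finset.sum_congr rfl fun x _ => ?_
  simp only [neg_one_pow_val_add, mul_zero, mul_one, ZMod.val_zero, pow_zero]
  ring

theorem walsh_one_add {n : ℕ} (f : BV n → ZMod 2) (a : BV n) :
    walsh (fun x => 1 + f x) a = -walsh f a := by
  simp [walsh, neg_one_pow_val_add, ZMod.val_one]

theorem walshC_concat {n : ℕ} (f1 f2 f3 f4 : BV n → ZMod 2) (a : BV n) (b c : ZMod 2) :
    walshC (concat f1 f2 f3 f4) (a, (b, c)) =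
      walsh f1 a + (-1) ^ c.val * walsh f2 a
        + (-1) ^ b.val * (walsh f3 a + (-1) ^ c.val * walsh f4 a) := by
  rw [walshC_eq]
  simp only [concat]
  congr! 5 <;> grind

theorem stmt15 {n m : ℕ} (hnm : n = 2 * m) (hm : 1 ≤ m)
    (f1 f3 : BV n → ZMod 2)
    (hb1 : ∀ a, walsh f1 a = 2 ^ m ∨ walsh f1 a = -(2 ^ m))
    (hb3 : ∀ a, walsh f3 a = 2 ^ m ∨ walsh f3 a = -(2 ^ m))
    (hMM1 : ∃ U : Submodule (ZMod 2) (BV n),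
      Module.finrank (ZMod 2) ↥U = m ∧ IsMSub f1 U)
    (hf3M : ∀ W : Submodule (ZMod 2) (BV n),
      IsMSub f3 W → Module.finrank (ZMod 2) ↥W ≤ m - 2)
    (f4 : BV n → ZMod 2) (hf4 : ∀ x, f4 x = 1 + f3 x) :
    (∀ a, walshC (concat f1 f1 f3 f4) a = 2 ^ (m + 1) ∨
      walshC (concat f1 f1 f3 f4) a = -(2 ^ (m + 1))) ∧
    ¬ ∃ W : Submodule (ZMod 2) (BV n × (ZMod 2 × ZMod 2)),
      Module.finrank (ZMod 2) ↥W = m + 1 ∧ IsMSub (concat f1 f1 f3 f4) W := by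
  obtain rfl : f4 = fun x => 1 + f3 x := funext hf4
  constructor
  · rintro ⟨a, b, c⟩
    rw [walshC_concat, walsh_one_add, pow_succ]
    have hcases : ∀ c : ZMod 2, c = 0 ∨ c = 1 := by decide
    rcases hcases b with rfl | rfl <;> rcases hcases c with rfl | rfl <;>
      simp only [ZMod.val_zero, ZMod.val_one, pow_zero, pow_one] <;>
      rcases hb1 a with h1 | h1 <;> rcases hb3 a with h3 | h3 <;> rw [h1, h3] <;> grind
  · rintro ⟨W, hdim, hW⟩
    have hle := hf3M _ hW.comap_inl_concat
    have hrank := W.finrank_le_finrank_comap_inl_add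
    rw [hdim, Module.finrank_prod, Module.finrank_self] at hrank
    have : NeZero n := ⟨by omega⟩
    have hline := hf3M _ (isMSub_span_singleton f3 (fun _ => 1))
    rw [finrank_span_singleton fun h => one_ne_zero (congrFun h 0)] at hline
    omega
end
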